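/- Let G be a directed graph with unit-capacity edges and distinguished vertices i, j, l, and suppose the minimum cut separating i from j equals the minimum cut separating i from {j,l}: C_{i;j} = C_{i;{j,l}}. Then there exist a family P_{i;j} of pairwise edge-disjoint directed paths from i to j and a family P_{j;l} of pairwise edge-disjoint directed paths from j to l, with all paths in P_{i;j} ∪ P_{j;l} pairwise edge-disjoint, such that |P_{i;j}| = C_{i;{j,l}} and |P_{i;j}| + |P_{j;l}| = C_{j;{i,l}}. -/

import Mathlib

variable {V : Type*} [Fintype V] [DecidableEq V]

def cutVal (cap : V → V → ℕ) (A : Finset V) : ℕ :=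
  ∑ u ∈ A, ∑ v ∈ Aᶜ, cap u v

noncomputable def minCut (cap : V → V → ℕ) (s : V) (T : Finset V) : ℕ :=
  sInf {c | ∃ A : Finset V, s ∈ A ∧ (∀ t ∈ T, t ∉ A) ∧ c = cutVal cap A}

/-- Unit capacities determined by an adjacency predicate. -/
def capOf (E : V → V → Bool) : V → V → ℕ := fun u v => if E u v then 1 else 0

/-- A directed path from `s` to `t` along edges of `E`. -/
structure DiPath (E : V → V → Prop) (s t : V) where
  verts : List V
  ne : verts ≠ []
  first : verts.head? = some s
  last : verts.getLast? = some t
  chain : verts.Chain' E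

/-- The set of directed edges used by a path given as a vertex list. -/
def pathEdges (p : List V) : Finset (V × V) := (p.zip p.tail).toFinset

theorem cutVal_compl {cap : V → V → ℕ} (hcap : ∀ u v, cap u v = cap v u) (A : Finset V) :
    cutVal cap Aᶜ = cutVal cap A := by
  unfold cutVal
  rw [compl_compl, Finset.sum_comm]
  exact Finset.sum_congr rfl fun u _ => Finset.sum_congr rfl fun v _ => hcap v u

theorem cutVal_union_le (cap : V → V → ℕ) (A B : Finset V) :
    cutVal cap (A ∪ B) ≤ cutVal cap A + cutVal cap B := by
  have mono : ∀ X Y : Finset V, X ⊆ Y →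
      ∑ u ∈ X, ∑ v ∈ Yᶜ, cap u v ≤ cutVal cap X := fun X Y h =>
    Finset.sum_le_sum fun u _ =>
      Finset.sum_le_sum_of_subset (Finset.compl_subset_compl.2 h)
  have h : cutVal cap (A ∪ B) ≤
      ∑ u ∈ A, ∑ v ∈ (A ∪ B)ᶜ, cap u v + ∑ u ∈ B, ∑ v ∈ (A ∪ B)ᶜ, cap u v := by
    rw [← Finset.sum_union_inter]
    exact Nat.le_add_right _ _
  exact h.trans (add_le_add (mono A _ Finset.subset_union_left)
    (mono B _ Finset.subset_union_right))

theorem minCut_le_cutVal (cap : V → V → ℕ) {s : V} {T A : Finset V} (hs : s ∈ A)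
    (hT : ∀ t ∈ T, t ∉ A) : minCut cap s T ≤ cutVal cap A :=
  Nat.sInf_le ⟨A, hs, hT, rfl⟩

theorem exists_cutVal_eq_minCut (cap : V → V → ℕ) {s : V} {T : Finset V} (hs : s ∉ T) :
    ∃ A : Finset V, s ∈ A ∧ (∀ t ∈ T, t ∉ A) ∧ minCut cap s T = cutVal cap A :=
  Nat.sInf_mem (s := {c | ∃ A : Finset V, s ∈ A ∧ (∀ t ∈ T, t ∉ A) ∧ c = cutVal cap A})
    ⟨_, {s}, by simp, fun t ht h => hs (Finset.mem_singleton.1 h ▸ ht), rfl⟩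

omit [Fintype V] [DecidableEq V] in
theorem sum_sum_eq_zero_of_antisymm {f : V → V → ℤ} (hf : ∀ a b, f a b = -f b a)
    (A : Finset V) : ∑ a ∈ A, ∑ b ∈ A, f a b = 0 := by
  have h : ∑ a ∈ A, ∑ b ∈ A, f a b = -∑ a ∈ A, ∑ b ∈ A, f a b := by
    conv_lhs => rw [Finset.sum_comm]
    simp_rw [← Finset.sum_neg_distrib]
    exact Finset.sum_congr rfl fun a _ => Finset.sum_congr rfl fun b _ => hf b a
  omega

/-- The total divergence of a set is the net flow out of it. -/
theorem sum_divergence_eq {f : V → V → ℤ} (hf : ∀ a b, f a b = -f b a) (A : Finset V) :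
    ∑ a ∈ A, ∑ b, f a b = ∑ a ∈ A, ∑ b ∈ Aᶜ, f a b := by
  simp_rw [← Finset.sum_add_sum_compl A, Finset.sum_add_distrib,
    sum_sum_eq_zero_of_antisymm hf, zero_add]

omit [Fintype V] [DecidableEq V] in
theorem exists_step_avoiding {r : V → V → Prop} {u w : V} (h : Relation.ReflTransGen r u w)
    (huw : u ≠ w) : ∃ x, x ≠ u ∧ r u x ∧
      Relation.ReflTransGen (fun a b => a ≠ u ∧ b ≠ u ∧ r a b) x w := by
  induction h with
  | refl => exact absurd rfl huw
  | @tail b c _ hbc ih =>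
    by_cases hb : u = b
    · subst hb
      exact ⟨c, huw.symm, hbc, .refl⟩
    · obtain ⟨x, hx, hux, hxb⟩ := ih hb
      exact ⟨x, hx, hux, hxb.tail ⟨Ne.symm hb, huw.symm, hbc⟩⟩

/-- The edge relation `r` contains a path from `u` to `w` inside `S` together with the unit flow
`g` along it. -/
theorem exists_path_unit_flow_within {r : V → V → Prop} (S : Finset V) :
    ∀ u w, Relation.ReflTransGen (fun a b => a ∈ S ∧ b ∈ S ∧ r a b) u w →
    ∃ (p : List V) (g : V → V → ℤ), (u :: p).IsChain r ∧ (u :: p).getLast? = some w ∧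
      (∀ a b, g a b = -g b a) ∧ (∀ a b, 0 < g a b → r a b) ∧ (∀ a b, g a b ≤ 1) ∧
      (∀ a b, (a, b) ∈ pathEdges (u :: p) → g a b = 1) ∧
      (∀ a b, g a b ≠ 0 → a ∈ S ∧ b ∈ S) ∧
      ∀ a, ∑ b, g a b = (if a = u then 1 else 0) - (if a = w then 1 else 0) := by
  induction S using Finset.strongInduction with
  | H S ih =>
  intro u w h
  by_cases huw : u = w
  · subst huw
    exact ⟨[], 0, by simp, by simp, by simp, by simp, by simp, by simp [pathEdges], by simp,
      by simp⟩
  obtain ⟨x, hxu, ⟨huS, hxS, hr⟩, hxw⟩ := exists_step_avoiding h huw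
  obtain ⟨p, g, hchain, hlast, hanti, hpos, hle, hedge, hsupp, hdiv⟩ :=
    ih (S.erase u) (Finset.erase_ssubset huS) x w
      (Relation.ReflTransGen.mono (fun a b ⟨ha, hb, haS, hbS, hab⟩ =>
        ⟨Finset.mem_erase.2 ⟨ha, haS⟩, Finset.mem_erase.2 ⟨hb, hbS⟩, hab⟩) _ _ hxw)
  have hu1 : ∀ b, g u b = 0 := fun b => by
    by_contra hne
    simpa using (hsupp u b hne).1
  have hu2 : ∀ a, g a u = 0 := fun a => by rw [hanti, hu1, neg_zero]
  refine ⟨x :: p, fun a b => (if a = u ∧ b = x then 1 else 0) -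
    (if a = x ∧ b = u then 1 else 0) + g a b, ?_, ?_, ?_, ?_, ?_, ?_, ?_, ?_⟩
  · exact List.isChain_cons_cons.2 ⟨hr, hchain⟩
  · simpa [List.getLast?_cons_cons] using hlast
  · intro a b
    have := hanti a b
    grind
  · intro a b
    have := hpos a b
    grind
  · intro a b
    have := hle a b
    grind
  · intro a b hab
    have hab' : (a, b) = (u, x) ∨ (a, b) ∈ pathEdges (x :: p) := by
      simpa [pathEdges] using hab
    rcases hab' with hab' | hab'
    · grind
    · have := hedge a b hab'
      grind
  · intro a b hab
    by_cases hg : g a b = 0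
    · grind
    · have := hsupp a b hg
      exact ⟨Finset.mem_of_mem_erase this.1, Finset.mem_of_mem_erase this.2⟩
  · intro a
    simp only [Finset.sum_add_distrib, Finset.sum_sub_distrib, hdiv, ite_and]
    by_cases h1 : a = u <;> by_cases h2 : a = x <;> simp [h1, h2]

theorem exists_path_unit_flow {r : V → V → Prop} {u w : V} (h : Relation.ReflTransGen r u w) :
    ∃ (p : DiPath r u w) (g : V → V → ℤ),
      (∀ a b, g a b = -g b a) ∧ (∀ a b, 0 < g a b → r a b) ∧ (∀ a b, g a b ≤ 1) ∧
      (∀ a b, (a, b) ∈ pathEdges p.verts → g a b = 1) ∧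
      ∀ a, ∑ b, g a b = (if a = u then 1 else 0) - (if a = w then 1 else 0) := by
  obtain ⟨p, g, h1, h2, h3, h4, h5, h6, -, h7⟩ :=
    exists_path_unit_flow_within (r := r) Finset.univ u w
      (Relation.ReflTransGen.mono
        (fun a b hab => ⟨Finset.mem_univ a, Finset.mem_univ b, hab⟩) _ _ h)
  exact ⟨⟨u :: p, by simp, by simp, h2, h1⟩, g, h3, h4, h5, h6, h7⟩

/-- A balanced integral demand that no cut obstructs is met by an integral flow. -/
theorem exists_flow_of_demand_le_cutVal (cap : V → V → ℕ) (d : V → ℤ)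
    (hd : ∑ a, d a = 0) (hcut : ∀ A : Finset V, ∑ a ∈ A, d a ≤ cutVal cap A) :
    ∃ f : V → V → ℤ, (∀ a b, f a b = -f b a) ∧ (∀ a b, f a b ≤ cap a b) ∧
      ∀ a, ∑ b, f a b = d a := by
  classical
  let Φ := {f : V → V → ℤ // (∀ a b, f a b = -f b a) ∧ ∀ a b, f a b ≤ cap a b}
  have : Nonempty Φ := ⟨⟨0, by simp, by simp⟩⟩
  let φ : Φ → ℕ := fun f => ∑ a, (d a - ∑ b, f.1 a b).toNat
  obtain ⟨f, hmin⟩ : ∃ f, ∀ f', φ f ≤ φ f' :=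
    ⟨Function.argmin φ, fun f' => Function.argmin_le φ f'⟩
  obtain ⟨f, hanti, hle⟩ := f
  refine ⟨f, hanti, hle, ?_⟩
  have htot : ∑ a, (d a - ∑ b, f a b) = 0 := by
    rw [Finset.sum_sub_distrib, hd, sum_sum_eq_zero_of_antisymm hanti, sub_zero]
  by_contra hne
  obtain ⟨u, hu⟩ : ∃ u, 0 < d u - ∑ b, f u b := by
    by_contra! hall
    have := (Finset.sum_eq_zero_iff_of_nonpos fun a _ => hall a).1 htot
    exact hne fun a => by have := this a (Finset.mem_univ a); omega
  let R : Finset V :=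
    Finset.univ.filter fun w => Relation.ReflTransGen (fun a b => f a b < cap a b) u w
  have hR : ∀ w, w ∈ R ↔ Relation.ReflTransGen (fun a b => f a b < cap a b) u w := by
    simp [R]
  have hnonneg : ∀ w ∈ R, 0 ≤ d w - ∑ b, f w b := by
    intro w hw
    by_contra! hneg
    obtain ⟨-, g, gA, gpos, gle, -, gdiv⟩ := exists_path_unit_flow ((hR w).1 hw)
    have huw : u ≠ w := by
      rintro rfl
      omega
    have h := hmin ⟨fun a b => f a b + g a b, fun a b => by
      linarith [hanti a b, gA a b], fun a b => by
      beta_reduce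
      by_cases hg : 0 < g a b
      · have := gpos a b hg
        have := gle a b
        omega
      · have := hle a b
        omega⟩
    refine absurd h (not_le.2 ?_)
    refine Finset.sum_lt_sum (fun a _ => ?_) ⟨u, Finset.mem_univ u, ?_⟩
    · simp only [Finset.sum_add_distrib, gdiv]
      by_cases h1 : a = u
      · subst h1
        simp only [if_true, if_neg huw]
        omega
      · by_cases h2 : a = w
        · subst h2
          simp only [if_true, if_neg h1]
          omega
        · simp [h1, h2]
    · simp only [Finset.sum_add_distrib, gdiv, if_true, if_neg huw]
      omega
  have huR : u ∈ R := (hR u).2 .refl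
  have hsum : 0 < ∑ a ∈ R, (d a - ∑ b, f a b) :=
    Finset.sum_pos' hnonneg ⟨u, huR, hu⟩
  have hsat : ∑ a ∈ R, ∑ b, f a b = cutVal cap R := by
    rw [sum_divergence_eq hanti, cutVal]
    push_cast
    refine Finset.sum_congr rfl fun a ha => Finset.sum_congr rfl fun b hb => ?_
    by_contra hab
    exact Finset.mem_compl.1 hb
      ((hR b).2 (((hR a).1 ha).tail (lt_of_le_of_ne (hle a b) hab)))
  rw [Finset.sum_sub_distrib, hsat] at hsum
  have := hcut R
  omega

omit [Fintype V] in
theorem mem_pathEdges_iff_infix {p : List V} {a b : V} :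
    (a, b) ∈ pathEdges p ↔ [a, b] <:+: p := by
  induction p with
  | nil => simp [pathEdges]
  | cons x p ih =>
    cases p with
    | nil =>
      simp only [pathEdges, List.tail_cons, List.zip_nil_right, List.toFinset_nil,
        Finset.notMem_empty, false_iff]
      intro h
      simpa using h.length_le
    | cons y p =>
      have h : (a, b) ∈ pathEdges (x :: y :: p) ↔
          (a, b) = (x, y) ∨ (a, b) ∈ pathEdges (y :: p) := by simp [pathEdges]
      rw [h, ih, List.infix_cons_iff (l₂ := y :: p)]
      simp [List.cons_prefix_cons]

omit [Fintype V] in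
theorem mem_pathEdges_reverse {p : List V} {a b : V} :
    (a, b) ∈ pathEdges p.reverse ↔ (b, a) ∈ pathEdges p := by
  rw [mem_pathEdges_iff_infix, mem_pathEdges_iff_infix, ← List.reverse_infix]
  simp

omit [Fintype V] in
theorem DiPath.rel_of_mem_pathEdges {r : V → V → Prop} {s t : V} (p : DiPath r s t) {a b : V}
    (h : (a, b) ∈ pathEdges p.verts) : r a b := by
  have := List.IsChain.infix p.chain (mem_pathEdges_iff_infix.1 h)
  simpa using this

def DiPath.mono {r r' : V → V → Prop} {s t : V} (h : ∀ a b, r a b → r' a b)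
    (p : DiPath r s t) : DiPath r' s t :=
  ⟨p.verts, p.ne, p.first, p.last, List.IsChain.imp h p.chain⟩

def DiPath.reverse {r r' : V → V → Prop} {s t : V} (h : ∀ a b, r a b → r' b a)
    (p : DiPath r s t) : DiPath r' t s :=
  ⟨p.verts.reverse, by simpa using p.ne, by simpa using p.last, by simpa using p.first,
    List.isChain_reverse.2 (List.IsChain.imp h p.chain)⟩

/-- A unit-bounded flow from the sources `s k` to `t` decomposes into edge-disjoint paths. -/
theorem exists_disjoint_paths_of_flow (t : V) (N : ℕ) : ∀ (s : Fin N → V) (f : V → V → ℤ),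
    (∀ a b, f a b = -f b a) → (∀ a b, f a b ≤ 1) →
    (∀ a, ∑ b, f a b = (∑ k, if a = s k then 1 else 0) - if a = t then (N : ℤ) else 0) →
    ∃ P : ∀ k, DiPath (fun a b => 0 < f a b) (s k) t,
      ∀ x y, x ≠ y → Disjoint (pathEdges (P x).verts) (pathEdges (P y).verts) := by
  classical
  induction N with
  | zero => exact fun s f _ _ _ => ⟨fun k => k.elim0, fun k => k.elim0⟩
  | succ N ih =>
    intro s f hanti hle hdiv
    have hreach : Relation.ReflTransGen (fun a b => 0 < f a b) (s 0) t := by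
      by_contra hnot
      let R : Finset V :=
        Finset.univ.filter fun w => Relation.ReflTransGen (fun a b => 0 < f a b) (s 0) w
      have hR : ∀ w, w ∈ R ↔ Relation.ReflTransGen (fun a b => 0 < f a b) (s 0) w := by
        simp [R]
      have hneg : ∑ a ∈ R, ∑ b, f a b ≤ 0 := by
        rw [sum_divergence_eq hanti]
        refine Finset.sum_nonpos fun a ha => Finset.sum_nonpos fun b hb => ?_
        by_contra! hab
        exact Finset.mem_compl.1 hb ((hR b).2 (((hR a).1 ha).tail hab))
      refine absurd hneg (not_le.2 ?_)
      have hnt : ∀ a ∈ R, a ≠ t := by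
        rintro a ha rfl
        exact hnot ((hR a).1 ha)
      refine Finset.sum_pos' (fun a ha => ?_) ⟨s 0, (hR _).2 .refl, ?_⟩
      · rw [hdiv, if_neg (hnt a ha), sub_zero]
        exact Finset.sum_nonneg fun k _ => by split_ifs <;> simp
      · rw [hdiv, if_neg (hnt _ ((hR _).2 .refl)), sub_zero]
        exact Finset.sum_pos' (fun k _ => by split_ifs <;> simp) ⟨0, by simp⟩
    obtain ⟨p, g, gA, gpos, gle, gedge, gdiv⟩ := exists_path_unit_flow hreach
    have hsub : ∀ a b, 0 < f a b - g a b → 0 < f a b := fun a b h => by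
      by_contra hf
      have h1 := gpos b a
      have h2 := gA a b
      have h3 := gle b a
      have h4 := hanti a b
      have h5 := hle b a
      omega
    obtain ⟨P, hP⟩ := ih (fun k => s k.succ) (fun a b => f a b - g a b)
      (fun a b => by rw [hanti, gA]; ring)
      (fun a b => by
        by_contra! h
        have h0 := hsub a b (by omega)
        have h1 := gpos b a
        have h2 := gA a b
        have h3 := hle a b
        have h4 := hanti a b
        omega)
      (fun a => by
        rw [Finset.sum_sub_distrib, hdiv, gdiv, Fin.sum_univ_succ]
        push_cast
        split_ifs <;> ring)
    have hdisj : ∀ k, Disjoint (pathEdges p.verts) (pathEdges (P k).verts) := fun k => by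
      rw [Finset.disjoint_left]
      rintro ⟨a, b⟩ h1 h2
      have h3 := (P k).rel_of_mem_pathEdges h2
      have h4 := gedge a b h1
      have h5 := hle a b
      omega
    refine ⟨Fin.cases p fun k => (P k).mono hsub, fun x y => ?_⟩
    refine Fin.cases ?_ (fun x => ?_) x <;> refine Fin.cases ?_ (fun y => ?_) y
    · exact fun h => absurd rfl h
    · exact fun _ => hdisj y
    · exact fun _ => (hdisj x).symm
    · exact fun h => hP x y fun hxy => h (by rw [hxy])

/-- Lemma 2: in a bidirectional unit-capacity graph with C_{i;j} = C_{i;{j,l}},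
there exist C_{i;{j,l}} edge-disjoint i→j paths and C_{j;{i,l}} − C_{i;{j,l}}
edge-disjoint j→l paths, all pairwise edge-disjoint. -/
theorem stmt5 (E : V → V → Bool) (hsymm : ∀ u v, E u v = E v u)
    (i j l : V) (hij : i ≠ j) (hil : i ≠ l) (hjl : j ≠ l)
    (hcut : minCut (capOf E) i {j} = minCut (capOf E) i {j, l}) :
    ∃ (n m : ℕ)
      (P : Fin n → DiPath (fun u v => E u v = true) i j)
      (Q : Fin m → DiPath (fun u v => E u v = true) j l),
      n = minCut (capOf E) i {j, l} ∧
      n + m = minCut (capOf E) j {i, l} ∧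
      (∀ x y : Fin n, x ≠ y → Disjoint (pathEdges (P x).verts) (pathEdges (P y).verts)) ∧
      (∀ x y : Fin m, x ≠ y → Disjoint (pathEdges (Q x).verts) (pathEdges (Q y).verts)) ∧
      (∀ (x : Fin n) (y : Fin m), Disjoint (pathEdges (P x).verts) (pathEdges (Q y).verts)) := by
  have hcap : ∀ u v, capOf E u v = capOf E v u := fun u v => by simp [capOf, hsymm u v]
  have hi : ∀ A : Finset V, i ∈ A → j ∉ A → l ∉ A →
      minCut (capOf E) i {j, l} ≤ cutVal (capOf E) A := fun A h1 h2 h3 =>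
    minCut_le_cutVal _ h1 (by simp [h2, h3])
  have hj : ∀ A : Finset V, i ∈ A → j ∉ A → l ∈ A →
      minCut (capOf E) j {i, l} ≤ cutVal (capOf E) A := fun A h1 h2 h3 => by
    rw [← cutVal_compl hcap]
    exact minCut_le_cutVal _ (by simpa using h2) (by simp [h1, h3])
  obtain ⟨m, hm⟩ : ∃ m, minCut (capOf E) j {i, l} = minCut (capOf E) i {j, l} + m := by
    refine Nat.exists_eq_add_of_le ?_
    obtain ⟨A, hA1, hA2, hA⟩ :=
      exists_cutVal_eq_minCut (capOf E) (s := j) (T := {i, l}) (by simp [hij.symm, hjl])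
    rw [hA, ← hcut, ← cutVal_compl hcap]
    exact minCut_le_cutVal _ (by simpa using hA2 i (by simp)) (by simpa using hA1)
  obtain ⟨B, hB1, hB2, hB⟩ :=
    exists_cutVal_eq_minCut (capOf E) (s := i) (T := {j, l}) (by simp [hij, hil])
  generalize minCut (capOf E) i {j, l} = n at *
  have hl : ∀ A : Finset V, l ∈ A → j ∉ A → m ≤ cutVal (capOf E) A := fun A h1 h2 => by
    have h3 := hj (A ∪ B) (by simp [hB1]) (by simp [h2, hB2 j]) (by simp [h1])
    have h4 := cutVal_union_le (capOf E) A B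
    omega
  obtain ⟨f, hanti, hle, hdiv⟩ := exists_flow_of_demand_le_cutVal (capOf E)
    (fun a => (if a = i then (n : ℤ) else 0) + (if a = l then (m : ℤ) else 0)
      - if a = j then ((n + m : ℕ) : ℤ) else 0)
    (by simp [Finset.sum_add_distrib])
    (fun A => by
      simp only [Finset.sum_add_distrib, Finset.sum_sub_distrib, Finset.sum_ite_eq']
      have h1 := hi A
      have h2 := hj A
      have h3 := hl A
      split_ifs with c1 c2 c3 c3 c2 c3 c3
      all_goals simp only [c1, c2, c3, not_true, not_false_iff, true_imp_iff,
        false_imp_iff] at h1 h2 h3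
      all_goals omega)
  have hle1 : ∀ a b, f a b ≤ 1 := fun a b => (hle a b).trans (by unfold capOf; split_ifs <;> simp)
  have hE : ∀ a b, 0 < f a b → E a b = true := fun a b h => by
    by_contra hne
    have := hle a b
    simp only [capOf, if_neg hne] at this
    omega
  obtain ⟨P, hP⟩ := exists_disjoint_paths_of_flow j (n + m)
    (Fin.append (fun _ : Fin n => i) (fun _ : Fin m => l)) f hanti hle1
    (fun a => by
      rw [hdiv, Fin.sum_univ_add]
      simp)
  have hPi : ∀ x : Fin n, Fin.append (fun _ : Fin n => i) (fun _ : Fin m => l)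
      (Fin.castAdd m x) = i := fun x => by simp
  have hPl : ∀ y : Fin m, Fin.append (fun _ : Fin n => i) (fun _ : Fin m => l)
      (Fin.natAdd n y) = l := fun y => by simp
  have hPE : ∀ k a b, (a, b) ∈ pathEdges (P k).verts → 0 < f a b :=
    fun k a b => (P k).rel_of_mem_pathEdges
  refine ⟨n, m,
    fun x => ⟨(P (Fin.castAdd m x)).verts, (P _).ne, by rw [(P _).first, hPi], (P _).last,
      ((P (Fin.castAdd m x)).mono hE).chain⟩,
    fun y => ⟨(P (Fin.natAdd n y)).verts.reverse, by simpa using (P _).ne,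
      by simpa using (P _).last, by rw [List.getLast?_reverse, (P _).first, hPl],
      ((P (Fin.natAdd n y)).reverse fun a b h => (hsymm b a).trans (hE a b h)).chain⟩,
    rfl, hm.symm, fun x y hxy => hP _ _ (by simpa using hxy), fun x y hxy => ?_,
    fun x y => ?_⟩
  · rw [Finset.disjoint_left]
    rintro ⟨a, b⟩ h1 h2
    exact Finset.disjoint_left.1 (hP (Fin.natAdd n x) (Fin.natAdd n y) (by simpa using hxy))
      (mem_pathEdges_reverse.1 h1) (mem_pathEdges_reverse.1 h2)
  · rw [Finset.disjoint_left]
    rintro ⟨a, b⟩ h1 h2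
    have h3 := hPE _ _ _ h1
    have h4 := hPE _ _ _ (mem_pathEdges_reverse.1 h2)
    have h5 := hanti a b
    omega
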